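/- Let U ⊆ ℍ be open and let f : U → ℍ be given by f(x) = f₁(x₁,x₂,x₃,x₄)e₁ + ∑ₖ₌₂⁴ xₖ f₀(x₁,x₂,x₃,x₄)eₖ, where f₀, f₁ : ℝ⁴ → ℝ are C¹. Then f is algebraic regular on U if and only if for every x ∈ U both (D_ℓ f)(x) = R(x)·e₁ and (D_r f)(x) = R(x)·e₁, where R(x) := 2[x₂∂f₀/∂x₂ + x₃∂f₀/∂x₃ + x₄∂f₀/∂x₄ − (x₂+x₃+x₄)∂f₀/∂x₁ − (∂f₁/∂x₁ + ∂f₁/∂x₂ + ∂f₁/∂x₃ + ∂f₁/∂x₄)] evaluated at (x₁,x₂,x₃,x₄). -/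

import Mathlib

open scoped Quaternion

noncomputable section

/-- The standard basis `e₁ = 1, e₂ = i, e₃ = j, e₄ = k` of the quaternions. -/
def e : Fin 4 → ℍ[ℝ] := ![1, ⟨0,1,0,0⟩, ⟨0,0,1,0⟩, ⟨0,0,0,1⟩]

/-- The real coordinates of a quaternion. -/
def toTuple (x : ℍ[ℝ]) : Fin 4 → ℝ := ![x.re, x.imI, x.imJ, x.imK]
/-- The `i`-th partial derivative of a function `g : ℝ⁴ → ℝ`. -/
def pd (g : (Fin 4 → ℝ) → ℝ) (i : Fin 4) (p : Fin 4 → ℝ) : ℝ :=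
  fderiv ℝ g p (Pi.single i 1)

/-- `f` is given on `U` by `f(x) = f₁(x₁,x₂,x₃,x₄)e₁ + ∑ₖ₌₂⁴ xₖ f₀(x₁,x₂,x₃,x₄)eₖ`. -/
def Represents (f : ℍ[ℝ] → ℍ[ℝ]) (U : Set ℍ[ℝ]) (f₀ f₁ : (Fin 4 → ℝ) → ℝ) : Prop :=
  ∀ x ∈ U, f x = f₁ (toTuple x) • e 0 + (x.imI * f₀ (toTuple x)) • e 1 +
    (x.imJ * f₀ (toTuple x)) • e 2 + (x.imK * f₀ (toTuple x)) • e 3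

/-- The generalized Cauchy–Riemann equations (ii) of algebraic regularity, at `p ∈ ℝ⁴`. -/
def RegularEqs (f₀ f₁ : (Fin 4 → ℝ) → ℝ) (p : Fin 4 → ℝ) : Prop :=
  pd f₁ 0 p = f₀ p + p 1 * pd f₀ 1 p + p 2 * pd f₀ 2 p + p 3 * pd f₀ 3 p ∧
  (∀ i : Fin 4, i ≠ 0 → pd f₁ i p = -(p i * pd f₀ 0 p)) ∧
  (∀ i j : Fin 4, i ≠ 0 → j ≠ 0 → i ≠ j → p i * pd f₀ j p = p j * pd f₀ i p)

/-- `f` is algebraic regular at `c ∈ U`. -/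
def AlgebraicRegularAt (f : ℍ[ℝ] → ℍ[ℝ]) (U : Set ℍ[ℝ]) (c : ℍ[ℝ]) : Prop :=
  ∃ f₀ f₁ : (Fin 4 → ℝ) → ℝ, ContDiff ℝ 1 f₀ ∧ ContDiff ℝ 1 f₁ ∧
    Represents f U f₀ f₁ ∧ RegularEqs f₀ f₁ (toTuple c)

/-- `f` is algebraic regular on `U`. -/
def AlgebraicRegularOn (f : ℍ[ℝ] → ℍ[ℝ]) (U : Set ℍ[ℝ]) : Prop :=
  ∀ c ∈ U, AlgebraicRegularAt f U c

/-- The real coordinates of a quaternion, as a continuous linear map. -/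
def toTupleCLM : ℍ[ℝ] →L[ℝ] (Fin 4 → ℝ) :=
  LinearMap.toContinuousLinearMap
    { toFun := toTuple
      map_add' := fun x y => by ext i; fin_cases i <;> simp [toTuple]
      map_smul' := fun r x => by ext i; fin_cases i <;> simp [toTuple] }

theorem toTupleCLM_apply (x : ℍ[ℝ]) : toTupleCLM x = toTuple x := rfl

theorem e_re (i : Fin 4) : (e i).re = if i = 0 then 1 else 0 := by
  fin_cases i <;> simp [e]

theorem e_imI (i : Fin 4) : (e i).imI = if i = 1 then 1 else 0 := by
  fin_cases i <;> simp [e]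

theorem e_imJ (i : Fin 4) : (e i).imJ = if i = 2 then 1 else 0 := by
  fin_cases i <;> simp [e]

theorem e_imK (i : Fin 4) : (e i).imK = if i = 3 then 1 else 0 := by
  fin_cases i <;> simp [e]

theorem toTuple_e (i : Fin 4) : toTuple (e i) = Pi.single i 1 := by
  ext j
  fin_cases i <;> fin_cases j <;> simp [toTuple, e]

theorem hasFDerivAt_comp_toTuple {g : (Fin 4 → ℝ) → ℝ} (hg : ContDiff ℝ 1 g) (x : ℍ[ℝ]) :
    HasFDerivAt (fun y => g (toTuple y)) ((fderiv ℝ g (toTuple x)).comp toTupleCLM) x :=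
  HasFDerivAt.comp (f := toTuple) x ((hg.differentiable one_ne_zero _).hasFDerivAt)
    toTupleCLM.hasFDerivAt

theorem fderiv_comp_toTuple_e {g : (Fin 4 → ℝ) → ℝ} (hg : ContDiff ℝ 1 g) (x : ℍ[ℝ]) (i : Fin 4) :
    fderiv ℝ (fun y => g (toTuple y)) x (e i) = pd g i (toTuple x) := by
  rw [(hasFDerivAt_comp_toTuple hg x).fderiv, ContinuousLinearMap.comp_apply, toTupleCLM_apply,
    toTuple_e, pd]

theorem pd_eq_of_eqOn {U : Set ℍ[ℝ]} (hU : IsOpen U) {g h : (Fin 4 → ℝ) → ℝ}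
    (hg : ContDiff ℝ 1 g) (hh : ContDiff ℝ 1 h)
    (hgh : ∀ x ∈ U, g (toTuple x) = h (toTuple x)) {x : ℍ[ℝ]} (hx : x ∈ U) (i : Fin 4) :
    pd g i (toTuple x) = pd h i (toTuple x) := by
  rw [← fderiv_comp_toTuple_e hg, ← fderiv_comp_toTuple_e hh]
  congr 1
  exact Filter.EventuallyEq.fderiv_eq (Filter.eventually_of_mem (hU.mem_nhds hx) hgh)

theorem Represents.fst_unique {f : ℍ[ℝ] → ℍ[ℝ]} {U : Set ℍ[ℝ]} {f₀ f₁ g₀ g₁ : (Fin 4 → ℝ) → ℝ}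
    (hf : Represents f U f₀ f₁) (hg : Represents f U g₀ g₁) {x : ℍ[ℝ]} (hx : x ∈ U) :
    f₁ (toTuple x) = g₁ (toTuple x) := by
  simpa [e_re] using congrArg QuaternionAlgebra.re ((hf x hx).symm.trans (hg x hx))

/-- Where `x₂ ≠ 0` the factor `f₀` is read off from `f`; the remaining points follow
by continuity along the direction `e₂ = i`. -/
theorem Represents.zeroth_unique {f : ℍ[ℝ] → ℍ[ℝ]} {U : Set ℍ[ℝ]} (hU : IsOpen U)
    {f₀ f₁ g₀ g₁ : (Fin 4 → ℝ) → ℝ} (hf₀ : Continuous f₀) (hg₀ : Continuous g₀)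
    (hf : Represents f U f₀ f₁) (hg : Represents f U g₀ g₁) {x : ℍ[ℝ]} (hx : x ∈ U) :
    f₀ (toTuple x) = g₀ (toTuple x) := by
  have off : ∀ y ∈ U, y.imI ≠ 0 → f₀ (toTuple y) = g₀ (toTuple y) := fun y hy hy0 => by
    have h := congrArg QuaternionAlgebra.imI ((hf y hy).symm.trans (hg y hy))
    simpa [e_imI, hy0] using h
  by_cases hx0 : x.imI = 0
  swap
  · exact off x hx hx0
  have hline : Continuous fun t : ℝ => x + t • e 1 := by fun_prop
  have htuple : Continuous toTuple := toTupleCLM.continuous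
  have hlim : ∀ g : (Fin 4 → ℝ) → ℝ, Continuous g →
      Filter.Tendsto (fun t : ℝ => g (toTuple (x + t • e 1))) (nhdsWithin 0 {0}ᶜ)
        (nhds (g (toTuple x))) := fun g hg => by
    have h := ((hg.comp (htuple.comp hline)).tendsto 0).mono_left
      (nhdsWithin_le_nhds (s := {0}ᶜ))
    simpa [Function.comp_def] using h
  refine tendsto_nhds_unique_of_eventuallyEq (hlim f₀ hf₀) (hlim g₀ hg₀) ?_
  have hmem : ∀ᶠ t : ℝ in nhds 0, x + t • e 1 ∈ U :=
    hline.continuousAt.eventually_mem (hU.mem_nhds (by simpa using hx))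
  filter_upwards [nhdsWithin_le_nhds hmem, self_mem_nhdsWithin] with t ht ht0
  refine off _ ht ?_
  simpa [e_imI, hx0] using ht0

/-- The partial derivatives of `f` in terms of those of `f₀` and `f₁`. -/
theorem Represents.fderiv_e {f : ℍ[ℝ] → ℍ[ℝ]} {U : Set ℍ[ℝ]} (hU : IsOpen U)
    {f₀ f₁ : (Fin 4 → ℝ) → ℝ} (hf₀ : ContDiff ℝ 1 f₀) (hf₁ : ContDiff ℝ 1 f₁)
    (hf : Represents f U f₀ f₁) {x : ℍ[ℝ]} (hx : x ∈ U) (i : Fin 4) :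
    fderiv ℝ f x (e i) = pd f₁ i (toTuple x) • e 0 +
      (x.imI * pd f₀ i (toTuple x) + f₀ (toTuple x) * (e i).imI) • e 1 +
      (x.imJ * pd f₀ i (toTuple x) + f₀ (toTuple x) * (e i).imJ) • e 2 +
      (x.imK * pd f₀ i (toTuple x) + f₀ (toTuple x) * (e i).imK) • e 3 := by
  have hcoord : ∀ k : Fin 4, HasFDerivAt (fun y : ℍ[ℝ] => toTuple y k)
      ((ContinuousLinearMap.proj k).comp toTupleCLM) x := fun k =>
    ((ContinuousLinearMap.proj (R := ℝ) (φ := fun _ : Fin 4 => ℝ) k).comp toTupleCLM).hasFDerivAt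
  have h₀ := hasFDerivAt_comp_toTuple hf₀ x
  have h₁ := hasFDerivAt_comp_toTuple hf₁ x
  have h := (((h₁.smul_const (e 0)).add (((hcoord 1).mul h₀).smul_const (e 1))).add
    (((hcoord 2).mul h₀).smul_const (e 2))).add (((hcoord 3).mul h₀).smul_const (e 3))
  have heq := h.congr_of_eventuallyEq (Filter.eventually_of_mem (hU.mem_nhds hx) hf)
  rw [heq.fderiv]
  simp only [add_apply, ContinuousLinearMap.smulRight_apply,
    smul_apply, ContinuousLinearMap.comp_apply, toTupleCLM_apply, toTuple_e,
    ContinuousLinearMap.proj_apply, pd, smul_eq_mul]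
  simp only [← toTuple_e]
  rfl

theorem regularEqs_iff (f₀ f₁ : (Fin 4 → ℝ) → ℝ) (p : Fin 4 → ℝ) :
    RegularEqs f₀ f₁ p ↔
      pd f₁ 0 p = f₀ p + p 1 * pd f₀ 1 p + p 2 * pd f₀ 2 p + p 3 * pd f₀ 3 p ∧
      (pd f₁ 1 p = -(p 1 * pd f₀ 0 p) ∧ pd f₁ 2 p = -(p 2 * pd f₀ 0 p) ∧
        pd f₁ 3 p = -(p 3 * pd f₀ 0 p)) ∧
      p 1 * pd f₀ 2 p = p 2 * pd f₀ 1 p ∧ p 1 * pd f₀ 3 p = p 3 * pd f₀ 1 p ∧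
        p 2 * pd f₀ 3 p = p 3 * pd f₀ 2 p := by
  constructor
  · rintro ⟨h, h', h''⟩
    exact ⟨h, ⟨h' 1 (by decide), h' 2 (by decide), h' 3 (by decide)⟩,
      h'' 1 2 (by decide) (by decide) (by decide), h'' 1 3 (by decide) (by decide) (by decide),
      h'' 2 3 (by decide) (by decide) (by decide)⟩
  · rintro ⟨h, ⟨h1, h2, h3⟩, h12, h13, h23⟩
    refine ⟨h, fun i hi => ?_, fun i j hi hj hij => ?_⟩
    · fin_cases i <;> first | exact absurd rfl hi | assumption
    · fin_cases i <;> fin_cases j <;>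
        first
        | exact absurd rfl hi
        | exact absurd rfl hj
        | exact absurd rfl hij
        | assumption
        | (symm; assumption)

theorem algebraicRegularOn_iff_regularEqs {f : ℍ[ℝ] → ℍ[ℝ]} {U : Set ℍ[ℝ]} (hU : IsOpen U)
    {f₀ f₁ : (Fin 4 → ℝ) → ℝ} (hf₀ : ContDiff ℝ 1 f₀) (hf₁ : ContDiff ℝ 1 f₁)
    (hf : Represents f U f₀ f₁) :
    AlgebraicRegularOn f U ↔ ∀ x ∈ U, RegularEqs f₀ f₁ (toTuple x) := by
  refine ⟨fun h x hx => ?_, fun h x hx => ⟨f₀, f₁, hf₀, hf₁, hf, h x hx⟩⟩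
  obtain ⟨g₀, g₁, hg₀, hg₁, hg, hreg⟩ := h x hx
  have eq₀ : ∀ y ∈ U, f₀ (toTuple y) = g₀ (toTuple y) := fun y hy =>
    hf.zeroth_unique hU hf₀.continuous hg₀.continuous hg hy
  have eq₁ : ∀ y ∈ U, f₁ (toTuple y) = g₁ (toTuple y) := fun y hy => hf.fst_unique hg hy
  simpa only [RegularEqs, eq₀ x hx, pd_eq_of_eqOn hU hf₀ hg₀ eq₀ hx,
    pd_eq_of_eqOn hU hf₁ hg₁ eq₁ hx] using hreg

/-- `f` is algebraic regular on `U` iff `D_ℓ f = R·e₁` and `D_r f = R·e₁` on `U`,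
where `R = 2[x₂∂f₀/∂x₂ + x₃∂f₀/∂x₃ + x₄∂f₀/∂x₄ − (x₂+x₃+x₄)∂f₀/∂x₁ − (∂f₁/∂x₁+∂f₁/∂x₂+∂f₁/∂x₃+∂f₁/∂x₄)]`. -/
theorem algebraicRegularOn_iff_fueter (U : Set ℍ[ℝ]) (hU : IsOpen U)
    (f : ℍ[ℝ] → ℍ[ℝ]) (f₀ f₁ : (Fin 4 → ℝ) → ℝ)
    (hf₀ : ContDiff ℝ 1 f₀) (hf₁ : ContDiff ℝ 1 f₁)
    (hf : Represents f U f₀ f₁) :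
    AlgebraicRegularOn f U ↔
      ∀ x ∈ U,
        (∑ i : Fin 4, e i * fderiv ℝ f x (e i)) =
          (2 * (toTuple x 1 * pd f₀ 1 (toTuple x) + toTuple x 2 * pd f₀ 2 (toTuple x) +
                toTuple x 3 * pd f₀ 3 (toTuple x) -
                (toTuple x 1 + toTuple x 2 + toTuple x 3) * pd f₀ 0 (toTuple x) -
                (pd f₁ 0 (toTuple x) + pd f₁ 1 (toTuple x) + pd f₁ 2 (toTuple x) +
                 pd f₁ 3 (toTuple x)))) • e 0 ∧
        (∑ i : Fin 4, fderiv ℝ f x (e i) * e i) =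
          (2 * (toTuple x 1 * pd f₀ 1 (toTuple x) + toTuple x 2 * pd f₀ 2 (toTuple x) +
                toTuple x 3 * pd f₀ 3 (toTuple x) -
                (toTuple x 1 + toTuple x 2 + toTuple x 3) * pd f₀ 0 (toTuple x) -
                (pd f₁ 0 (toTuple x) + pd f₁ 1 (toTuple x) + pd f₁ 2 (toTuple x) +
                 pd f₁ 3 (toTuple x)))) • e 0 := by
  rw [algebraicRegularOn_iff_regularEqs hU hf₀ hf₁ hf]
  refine forall₂_congr fun x hx => ?_
  rw [regularEqs_iff]
  simp only [Fin.sum_univ_four, hf.fderiv_e hU hf₀ hf₁ hx, Quaternion.ext_iff]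
  have c1 : toTuple x 1 = x.imI := rfl
  have c2 : toTuple x 2 = x.imJ := rfl
  have c3 : toTuple x 3 = x.imK := rfl
  simp only [c1, c2, c3]
  generalize toTuple x = p
  simp [e_re, e_imI, e_imJ, e_imK]
  constructor
  · rintro ⟨h, ⟨h1, h2, h3⟩, h12, h13, h23⟩
    refine ⟨⟨?_, ?_, ?_, ?_⟩, ?_, ?_, ?_, ?_⟩ <;> linarith
  · rintro ⟨⟨hl0, hl1, hl2, hl3⟩, hr0, hr1, hr2, hr3⟩
    refine ⟨?_, ⟨?_, ?_, ?_⟩, ?_, ?_, ?_⟩ <;> linarith
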